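/- arXiv:0812.5003 — 2 statements merged into one kernel-verified Lean document; each statement's English description precedes it below -/
import Mathlib

section
/- Let T be the centerless topological N=2 superconformal algebra, V = T⊗T with the adjoint diagonal action, and let d₀ ∈ Der(T, V) be a homogeneous derivation of degree 0. Then there exists u ∈ V_0 such that d₀ = u_inn; that is, every degree-zero homogeneous derivation from T to T⊗T is inner. -/
/-!
Common setup: the centerless topological N=2 superconformal algebra `T`,
modelled as the free ℂ-module on basis `{L_n, H_n, G_n, Q_n : n ∈ ℤ}`
(encoded as finitely supported functions `(N2Gen × ℤ) →₀ ℂ`), together with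
its super-bracket, the tensor square `TT` and cube `TTT` (modelled as
finitely supported functions on pairs/triples of indices), the adjoint
diagonal actions, the super-twist and super-cyclic maps, parity and degree
predicates, (inner) super-derivations, the coboundary map `Δ_r = innerDer r`,
the classical Yang–Baxter expression `c(r)`, and the Lie super-bialgebra
predicate.
-/

noncomputable section

/-- The four families of generators of the topological N=2 superconformal algebra. -/
inductive N2Gen : Type
  | L | H | G | Q
  deriving DecidableEq

/-- Index of a basis vector: a generator family together with an integer degree. -/
abbrev N2Idx : Type := N2Gen × ℤ

/-- ℤ/2-parity of a basis vector: `false` = even (`L`, `H`), `true` = odd (`G`, `Q`). -/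
def N2parity : N2Idx → Bool
  | (N2Gen.L, _) => false
  | (N2Gen.H, _) => false
  | (N2Gen.G, _) => true
  | (N2Gen.Q, _) => true

/-- The underlying vector space of the centerless topological N=2 superconformal
algebra: the free ℂ-module on the basis indexed by `N2Idx`. -/
abbrev TopN2 : Type := N2Idx →₀ ℂ

/-- The basis vector `L_n`, `H_n`, `G_n` or `Q_n`. -/
def bT (g : N2Gen) (n : ℤ) : TopN2 := Finsupp.single (g, n) 1

/-- The basis vector with index `i`. -/
def sing (i : N2Idx) : TopN2 := Finsupp.single i 1

/-- The bracket on basis vectors, given by the structure constants of the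
centerless topological N=2 superconformal algebra:
`[L_m,L_n] = (m−n)L_{m+n}`, `[L_m,H_n] = −n H_{m+n}`, `[L_m,G_n] = (m−n)G_{m+n}`,
`[L_m,Q_n] = −n Q_{m+n}`, `[H_m,G_n] = G_{m+n}`, `[H_m,Q_n] = −Q_{m+n}`,
`[G_m,Q_n] = 2L_{m+n} − 2n H_{m+n}`, extended super-skew-symmetrically,
all other brackets of basis vectors being zero. -/
def bracketAux : N2Idx → N2Idx → TopN2
  | (N2Gen.L, m), (N2Gen.L, n) => (m - n : ℂ) • bT N2Gen.L (m + n)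
  | (N2Gen.L, m), (N2Gen.H, n) => (-n : ℂ) • bT N2Gen.H (m + n)
  | (N2Gen.H, m), (N2Gen.L, n) => (m : ℂ) • bT N2Gen.H (m + n)
  | (N2Gen.L, m), (N2Gen.G, n) => (m - n : ℂ) • bT N2Gen.G (m + n)
  | (N2Gen.G, m), (N2Gen.L, n) => (m - n : ℂ) • bT N2Gen.G (m + n)
  | (N2Gen.L, m), (N2Gen.Q, n) => (-n : ℂ) • bT N2Gen.Q (m + n)
  | (N2Gen.Q, m), (N2Gen.L, n) => (m : ℂ) • bT N2Gen.Q (m + n)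
  | (N2Gen.H, m), (N2Gen.G, n) => bT N2Gen.G (m + n)
  | (N2Gen.G, m), (N2Gen.H, n) => -(bT N2Gen.G (m + n))
  | (N2Gen.H, m), (N2Gen.Q, n) => -(bT N2Gen.Q (m + n))
  | (N2Gen.Q, m), (N2Gen.H, n) => bT N2Gen.Q (m + n)
  | (N2Gen.G, m), (N2Gen.Q, n) =>
      (2 : ℂ) • bT N2Gen.L (m + n) + (-2 * n : ℂ) • bT N2Gen.H (m + n)
  | (N2Gen.Q, m), (N2Gen.G, n) =>
      (2 : ℂ) • bT N2Gen.L (m + n) + (-2 * m : ℂ) • bT N2Gen.H (m + n)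
  | _, _ => 0

/-- The super-bracket of `T`, extended bilinearly from the basis. -/
def brk (x y : TopN2) : TopN2 :=
  x.sum fun i a => y.sum fun j b => (a * b) • bracketAux i j

/-- The sign `(−1)^b` for a parity `b : Bool` (`false ↦ 1`, `true ↦ −1`). -/
def psgn (b : Bool) : ℂ := if b then -1 else 1

/-- The Koszul sign `(−1)^{[i][j]}` for two basis indices. -/
def ksgn (i j : N2Idx) : ℂ := psgn (N2parity i && N2parity j)

/-- `x` is ℤ/2-homogeneous of parity `q` (i.e. `x ∈ T^q`). -/
def IsParityT (q : Bool) (x : TopN2) : Prop := ∀ i ∈ x.support, N2parity i = q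

/-- `x` is ℤ-homogeneous of degree `n` (i.e. `x ∈ T_n = span{L_n,H_n,G_n,Q_n}`). -/
def IsDegT (n : ℤ) (x : TopN2) : Prop := ∀ i ∈ x.support, i.2 = n

/-- The tensor square `T ⊗ T`, modelled as the free ℂ-module on pairs of indices. -/
abbrev TT : Type := (N2Idx × N2Idx) →₀ ℂ

/-- Parity of a basis vector `e_{q.1} ⊗ e_{q.2}` of `T ⊗ T`. -/
def pparity (q : N2Idx × N2Idx) : Bool := xor (N2parity q.1) (N2parity q.2)

/-- `v ∈ T ⊗ T` is ℤ/2-homogeneous of parity `p`. -/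
def IsParityTT (p : Bool) (v : TT) : Prop := ∀ q ∈ v.support, pparity q = p

/-- `v ∈ T ⊗ T` is ℤ-homogeneous of degree `n`, i.e. `v ∈ V_n = Σ_{j+k=n} T_j ⊗ T_k`. -/
def IsDegTT (n : ℤ) (v : TT) : Prop := ∀ q ∈ v.support, q.1.2 + q.2.2 = n

/-- The tensor product map `T × T → T ⊗ T`. -/
def tmul2 (x y : TopN2) : TT :=
  x.sum fun i a => y.sum fun j b => Finsupp.single (i, j) (a * b)

/-- Adjoint diagonal action of the basis vector `e_i` on the basis tensor
`e_{q.1} ⊗ e_{q.2}`:  `[e_i,e_{q.1}] ⊗ e_{q.2} + (−1)^{[i][q.1]} e_{q.1} ⊗ [e_i,e_{q.2}]`. -/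
def actB (i : N2Idx) (q : N2Idx × N2Idx) : TT :=
  tmul2 (bracketAux i q.1) (sing q.2) + ksgn i q.1 • tmul2 (sing q.1) (bracketAux i q.2)

/-- The adjoint diagonal action `x · v` of `T` on `V = T ⊗ T`:
`x·(Σ aᵢ⊗bᵢ) = Σ([x,aᵢ]⊗bᵢ + (−1)^{[x][aᵢ]} aᵢ⊗[x,bᵢ])`. -/
def adT2 (x : TopN2) (v : TT) : TT :=
  x.sum fun i a => v.sum fun q c => (a * c) • actB i q

/-- The super-twist map `τ : T⊗T → T⊗T`, `τ(x₁⊗x₂) = (−1)^{[x₁][x₂]} x₂⊗x₁`. -/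
def twist (v : TT) : TT :=
  v.sum fun q c => (ksgn q.1 q.2 * c) • Finsupp.single (q.2, q.1) (1 : ℂ)

/-- The inner derivation `a_inn : x ↦ (−1)^{[a][x]} x·a` attached to `a ∈ T⊗T`
(extended bilinearly over the homogeneous components of `a` and `x`). -/
def innerDer (a : TT) (x : TopN2) : TT :=
  x.sum fun i c => a.sum fun q e =>
    (c * e * psgn (pparity q && N2parity i)) • actB i q

/-- `d : T → V = T⊗T` is a homogeneous super-derivation of parity `p`:
it is ℂ-linear, maps `T^q` into `V^{q+p}`, and satisfies the super Leibniz rule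
`d([x,y]) = (−1)^{p[x]} x·d(y) − (−1)^{[y](p+[x])} y·d(x)` on homogeneous elements. -/
def IsHomogDer (p : Bool) (d : TopN2 → TT) : Prop :=
  (∀ x y : TopN2, d (x + y) = d x + d y) ∧
  (∀ (c : ℂ) (x : TopN2), d (c • x) = c • d x) ∧
  (∀ (q : Bool) (x : TopN2), IsParityT q x → IsParityTT (xor p q) (d x)) ∧
  (∀ (qx qy : Bool) (x y : TopN2), IsParityT qx x → IsParityT qy y →
    d (brk x y) = psgn (p && qx) • adT2 x (d y) - psgn (qy && (xor p qx)) • adT2 y (d x))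

/-- The tensor cube `T ⊗ T ⊗ T`, modelled as the free ℂ-module on triples of indices. -/
abbrev TTT : Type := (N2Idx × N2Idx × N2Idx) →₀ ℂ

/-- The tensor product map `T × T × T → T ⊗ T ⊗ T`. -/
def tmul3 (x y z : TopN2) : TTT :=
  x.sum fun i a => y.sum fun j b => z.sum fun k c => Finsupp.single (i, j, k) (a * b * c)

/-- Adjoint diagonal action of the basis vector `e_i` on a basis vector of `T⊗T⊗T`. -/
def actB3 (i : N2Idx) (q : N2Idx × N2Idx × N2Idx) : TTT :=
  tmul3 (bracketAux i q.1) (sing q.2.1) (sing q.2.2)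
    + ksgn i q.1 • tmul3 (sing q.1) (bracketAux i q.2.1) (sing q.2.2)
    + (ksgn i q.1 * ksgn i q.2.1) • tmul3 (sing q.1) (sing q.2.1) (bracketAux i q.2.2)

/-- The adjoint diagonal action `x · w` of `T` on `T ⊗ T ⊗ T`. -/
def adT3 (x : TopN2) (w : TTT) : TTT :=
  x.sum fun i a => w.sum fun q c => (a * c) • actB3 i q

/-- The classical Yang–Baxter expression
`c(r) = [r^{12},r^{13}] + [r^{12},r^{23}] + [r^{13},r^{23}] ∈ T⊗T⊗T` for `r ∈ T⊗T`,
written out on homogeneous components with the Koszul signs of the super setting: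
for components `a⊗b` and `a'⊗b'` of `r`, the summand is
`(−1)^{[a'][b]} [a,a']⊗b⊗b' + a⊗[b,a']⊗b' + (−1)^{[a'][b]} a⊗a'⊗[b,b']`. -/
def cybe (r : TT) : TTT :=
  r.sum fun q α => r.sum fun q' β => (α * β) •
    ( ksgn q'.1 q.2 • tmul3 (bracketAux q.1 q'.1) (sing q.2) (sing q'.2)
      + tmul3 (sing q.1) (bracketAux q.2 q'.1) (sing q'.2)
      + ksgn q'.1 q.2 • tmul3 (sing q.1) (sing q'.1) (bracketAux q.2 q'.2) )

/-- Tensoring a basis vector of `T` on the left of an element of `T⊗T`. -/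
def embedL (i : N2Idx) (w : TT) : TTT :=
  w.sum fun q c => Finsupp.single (i, q.1, q.2) c

/-- The super-cyclic map `ξ : T⊗T⊗T → T⊗T⊗T`,
`ξ(x₁⊗x₂⊗x₃) = (−1)^{[x₁]([x₂]+[x₃])} x₂⊗x₃⊗x₁`. -/
def cyc (w : TTT) : TTT :=
  w.sum fun q c =>
    (psgn (N2parity q.1 && (xor (N2parity q.2.1) (N2parity q.2.2))) * c) •
      Finsupp.single (q.2.1, q.2.2, q.1) (1 : ℂ)

/-- `(1 ⊗ Δ) : T⊗T → T⊗T⊗T` for a (linear) map `Δ : T → T⊗T` of parity `p`,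
with the Koszul sign: `(1⊗Δ)(a⊗b) = (−1)^{p[a]} a ⊗ Δ(b)`. -/
def oneTensor (p : Bool) (D : TopN2 → TT) (v : TT) : TTT :=
  v.sum fun q c => (psgn (p && N2parity q.1) * c) • embedL q.1 (D (sing q.2))

/-- `(T,[·,·],D)` is a Lie super-bialgebra with comultiplication `D` of parity `p`:
`D` is ℂ-linear, respects the grading, has image in `Im(1⊗1 − τ)`, satisfies the
super co-Jacobi identity `(1 + ξ + ξ²)∘(1⊗D)∘D = 0`, and the compatibility
(1-cocycle) condition `D[x,y] = (−1)^{p[x]} x·D(y) − (−1)^{[y](p+[x])} y·D(x)`. -/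
def IsLieSuperBialgebra (p : Bool) (D : TopN2 → TT) : Prop :=
  (∀ x y : TopN2, D (x + y) = D x + D y) ∧
  (∀ (c : ℂ) (x : TopN2), D (c • x) = c • D x) ∧
  (∀ (q : Bool) (x : TopN2), IsParityT q x → IsParityTT (xor p q) (D x)) ∧
  (∀ x : TopN2, ∃ s : TT, D x = s - twist s) ∧
  (∀ x : TopN2,
    oneTensor p D (D x) + cyc (oneTensor p D (D x)) + cyc (cyc (oneTensor p D (D x))) = 0) ∧
  (∀ (qx qy : Bool) (x y : TopN2), IsParityT qx x → IsParityT qy y →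
    D (brk x y) = psgn (p && qx) • adT2 x (D y) - psgn (qy && (xor p qx)) • adT2 y (D x))

end

noncomputable section

namespace N2

open LaurentPolynomial

/-- The bilinear extension of `tmul2`. -/
def tL : TopN2 →ₗ[ℂ] TopN2 →ₗ[ℂ] TT :=
  Finsupp.linearCombination ℂ fun i =>
    Finsupp.linearCombination ℂ fun j => (Finsupp.single (i, j) 1 : TT)

lemma tmul2_eq_tL (x y : TopN2) : tmul2 x y = tL x y := by
  simp [tmul2, tL, Finsupp.linearCombination_apply, Finsupp.sum, LinearMap.sum_apply,
    Finset.smul_sum]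

lemma tL_sing (i j : N2Idx) : tL (sing i) (sing j) = Finsupp.single (i, j) 1 := by
  simp [tL, sing]

/-- The adjoint action of a basis vector. -/
def adL (i : N2Idx) : TopN2 →ₗ[ℂ] TopN2 := Finsupp.linearCombination ℂ (bracketAux i)

@[simp] lemma adL_sing (i j : N2Idx) : adL i (sing j) = bracketAux i j := by
  simp [adL, sing]

/-- The Koszul sign operator attached to a basis vector. -/
def signL (i : N2Idx) : TopN2 →ₗ[ℂ] TopN2 :=
  Finsupp.linearCombination ℂ fun k => ksgn i k • sing k

@[simp] lemma signL_sing (i j : N2Idx) : signL i (sing j) = ksgn i j • sing j := by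
  simp [signL, sing]

/-- The diagonal action of a basis vector on the tensor square. -/
def actL (i : N2Idx) : TT →ₗ[ℂ] TT := Finsupp.linearCombination ℂ (actB i)

lemma topN2_hom_ext {M : Type*} [AddCommMonoid M] [Module ℂ M] {f g : TopN2 →ₗ[ℂ] M}
    (h : ∀ i, f (sing i) = g (sing i)) : f = g :=
  Finsupp.lhom_ext' fun i => LinearMap.ext_ring (h i)

lemma tt_hom_ext {M : Type*} [AddCommMonoid M] [Module ℂ M] {f g : TT →ₗ[ℂ] M}
    (h : ∀ i j, f (tL (sing i) (sing j)) = g (tL (sing i) (sing j))) : f = g := by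
  refine Finsupp.lhom_ext' fun q => LinearMap.ext_ring ?_
  have := h q.1 q.2
  rwa [tL_sing] at this

lemma actL_tL (i : N2Idx) (x y : TopN2) :
    actL i (tL x y) = tL (adL i x) y + tL (signL i x) (adL i y) := by
  have : tL.compr₂ (actL i) = tL.comp (adL i) + tL.compl₁₂ (signL i) (adL i) := by
    refine topN2_hom_ext fun k => topN2_hom_ext fun l => ?_
    simp only [LinearMap.compr₂_apply, LinearMap.add_apply, LinearMap.comp_apply,
      LinearMap.compl₁₂_apply, adL_sing, signL_sing, tL_sing, map_smul, LinearMap.smul_apply]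
    simp [actL, actB, tmul2_eq_tL]
  exact LinearMap.congr_fun₂ this x y

lemma parity_of_bracketAux_ne_zero {i j k : N2Idx} (h : bracketAux i j k ≠ 0) :
    N2parity k = xor (N2parity i) (N2parity j) := by
  obtain ⟨a, m⟩ := i
  obtain ⟨b, n⟩ := j
  obtain ⟨c, l⟩ := k
  cases a <;> cases b <;> cases c <;>
    simp [bracketAux, bT, N2parity] at h ⊢

lemma linearCombination_bracketAux_congr {M : Type*} [AddCommMonoid M] [Module ℂ M]
    {i j : N2Idx} {f g : N2Idx → M}
    (h : ∀ k, N2parity k = xor (N2parity i) (N2parity j) → f k = g k) :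
    Finsupp.linearCombination ℂ f (bracketAux i j) =
      Finsupp.linearCombination ℂ g (bracketAux i j) := by
  simp only [Finsupp.linearCombination_apply]
  exact Finsupp.sum_congr fun k hk =>
    by rw [h k (parity_of_bracketAux_ne_zero (Finsupp.mem_support_iff.mp hk))]

lemma psgn_xor_and (a b c : Bool) : psgn (xor a b && c) = psgn (a && c) * psgn (b && c) := by
  cases a <;> cases b <;> cases c <;> simp [psgn]

lemma psgn_and_xor (a b c : Bool) : psgn (c && xor a b) = psgn (c && a) * psgn (c && b) := by
  cases a <;> cases b <;> cases c <;> simp [psgn]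

lemma ksgn_comm (i j : N2Idx) : ksgn i j = ksgn j i := by simp [ksgn, Bool.and_comm]

lemma ksgn_mul_self (i j : N2Idx) : ksgn i j * ksgn i j = 1 := by
  unfold ksgn psgn; split_ifs <;> norm_num

lemma bracketAux_eq_linearCombination (i j : N2Idx) :
    bracketAux i j = Finsupp.linearCombination ℂ sing (bracketAux i j) := by
  have : Finsupp.linearCombination ℂ sing = LinearMap.id :=
    topN2_hom_ext fun i => by simp [sing]
  rw [this]; rfl

lemma signL_bracketAux (i j k : N2Idx) :
    signL i (bracketAux j k) = (ksgn i j * ksgn i k) • bracketAux j k := by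
  rw [signL, linearCombination_bracketAux_congr (g := fun l => (ksgn i j * ksgn i k) • sing l)]
  · conv_rhs => rw [bracketAux_eq_linearCombination]
    simp [Finsupp.linearCombination_apply, Finsupp.smul_sum, smul_smul, mul_comm]
  · intro l hl
    simp only [ksgn, hl, psgn_and_xor]

lemma super_jacobi (i j l : N2Idx) :
    Finsupp.linearCombination ℂ (fun k => bracketAux k l) (bracketAux i j) =
      adL i (bracketAux j l) - ksgn i j • adL j (bracketAux i l) := by
  obtain ⟨a, m⟩ := i
  obtain ⟨b, n⟩ := j
  obtain ⟨c, r⟩ := l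
  have h1 : m + (n + r) = m + n + r := by ring
  have h2 : n + (m + r) = m + n + r := by ring
  cases a <;> cases b <;> cases c <;>
    (ext q
     simp only [bracketAux, adL, bT, ksgn, psgn, N2parity, map_smul, map_add, map_neg, map_zero,
       Finsupp.linearCombination_single, h1, h2, Finsupp.add_apply, Finsupp.sub_apply,
       Finsupp.smul_apply, Finsupp.neg_apply, smul_eq_mul, Finsupp.zero_apply, Bool.and_true,
       Bool.and_false, if_true, if_false, Bool.false_eq_true, one_smul, smul_zero, neg_zero]
     push_cast
     ring)

/-- The tensor square is a module over the superalgebra. -/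
lemma actL_bracketAux (i j : N2Idx) (v : TT) :
    Finsupp.linearCombination ℂ (fun k => actL k v) (bracketAux i j) =
      actL i (actL j v) - ksgn i j • actL j (actL i v) := by
  have key : Finsupp.linearCombination ℂ actL (bracketAux i j) =
      actL i ∘ₗ actL j - ksgn i j • (actL j ∘ₗ actL i) := by
    refine tt_hom_ext fun k l => ?_
    have e1 : Finsupp.linearCombination ℂ actL (bracketAux i j) (tL (sing k) (sing l)) =
        Finsupp.linearCombination ℂ (fun r => tL (bracketAux r k) (sing l)
          + (ksgn i k * ksgn j k) • tL (sing k) (bracketAux r l)) (bracketAux i j) := by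
      rw [← linearCombination_bracketAux_congr (f := fun r => actL r (tL (sing k) (sing l)))]
      · simp [Finsupp.linearCombination_apply, Finsupp.sum, LinearMap.sum_apply]
      · intro r hr
        simp [actL_tL, ksgn, hr, psgn_xor_and]
    have e2 : Finsupp.linearCombination ℂ (fun r => tL (bracketAux r k) (sing l)
          + (ksgn i k * ksgn j k) • tL (sing k) (bracketAux r l)) (bracketAux i j) =
        tL (Finsupp.linearCombination ℂ (fun r => bracketAux r k) (bracketAux i j)) (sing l) +
        (ksgn i k * ksgn j k) •
          tL (sing k) (Finsupp.linearCombination ℂ (fun r => bracketAux r l) (bracketAux i j)) := by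
      simp [Finsupp.linearCombination_apply, Finsupp.sum, LinearMap.sum_apply,
        Finset.sum_add_distrib, Finset.smul_sum, smul_comm (ksgn i k * ksgn j k)]
    rw [e1, e2, super_jacobi, super_jacobi]
    simp only [LinearMap.sub_apply, LinearMap.comp_apply, LinearMap.smul_apply, actL_tL, map_add,
      signL_bracketAux, ksgn_comm j i, map_smul, map_sub, signL_sing, adL_sing]
    have hs : ksgn i j * (ksgn i j * ksgn j k) = ksgn j k := by
      rw [← mul_assoc, ksgn_mul_self, one_mul]
    simp only [smul_add, smul_sub, smul_smul, hs]
    module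
  have := LinearMap.congr_fun key v
  simpa [Finsupp.linearCombination_apply, Finsupp.sum, LinearMap.sum_apply] using this

/-- The eigenvalue of `H_0` on a generator. -/
def charge : N2Gen → ℤ
  | .L => 0
  | .H => 0
  | .G => 1
  | .Q => -1

lemma bracketAux_H_zero (i : N2Idx) : bracketAux (.H, 0) i = (charge i.1 : ℂ) • sing i := by
  obtain ⟨a, m⟩ := i
  cases a <;> simp [bracketAux, bT, sing, charge]

lemma bracketAux_L_zero (i : N2Idx) : bracketAux (.L, 0) i = -(i.2 : ℂ) • sing i := by
  obtain ⟨a, m⟩ := i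
  cases a <;> simp [bracketAux, bT, sing]

lemma actL_apply_of_diagonal {i : N2Idx} {c : N2Idx → ℂ} (hi : N2parity i = false)
    (h : ∀ k, bracketAux i k = c k • sing k) (v : TT) (q : N2Idx × N2Idx) :
    actL i v q = (c q.1 + c q.2) * v q := by
  suffices Finsupp.lapply q ∘ₗ actL i = (c q.1 + c q.2) • Finsupp.lapply q by
    simpa using LinearMap.congr_fun this v
  refine tt_hom_ext fun k l => ?_
  simp only [LinearMap.comp_apply, LinearMap.smul_apply, actL_tL, adL_sing, h, signL_sing, ksgn, hi,
    map_smul, map_add]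
  simp only [tL_sing, Finsupp.lapply_apply]
  by_cases hq : (k, l) = q
  · subst hq; simp [psgn]
  · simp [hq]

lemma actL_H_zero_apply (v : TT) (q : N2Idx × N2Idx) :
    actL (.H, 0) v q = (charge q.1.1 + charge q.2.1 : ℤ) * v q := by
  rw [actL_apply_of_diagonal rfl bracketAux_H_zero]; push_cast; rfl

lemma actL_L_zero_apply (v : TT) (q : N2Idx × N2Idx) :
    actL (.L, 0) v q = -(q.1.2 + q.2.2 : ℤ) * v q := by
  rw [actL_apply_of_diagonal rfl bracketAux_L_zero]; push_cast; ring

lemma isDegTT_iff (n : ℤ) (v : TT) : IsDegTT n v ↔ actL (.L, 0) v = -(n : ℂ) • v := by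
  simp only [Finsupp.ext_iff, actL_L_zero_apply, IsDegTT, Finsupp.mem_support_iff]
  refine forall_congr' fun q => ?_
  simp only [Finsupp.smul_apply, smul_eq_mul]
  by_cases h : v q = 0
  · simp [h]
  · simp only [ne_eq, h, not_false_eq_true, true_imp_iff, mul_left_inj' h, neg_inj, Int.cast_inj]

lemma _root_.IsDegTT.add {n : ℤ} {v w : TT} (hv : IsDegTT n v) (hw : IsDegTT n w) :
    IsDegTT n (v + w) := by
  rw [isDegTT_iff] at hv hw ⊢
  rw [map_add, hv, hw, smul_add]

lemma _root_.IsDegTT.sub {n : ℤ} {v w : TT} (hv : IsDegTT n v) (hw : IsDegTT n w) :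
    IsDegTT n (v - w) := by
  rw [isDegTT_iff] at hv hw ⊢
  rw [map_sub, hv, hw, smul_sub]

lemma actL_actL_of_diagonal {h i : N2Idx} {c : ℂ} (hh : N2parity h = false)
    (hi : bracketAux h i = c • sing i) (v : TT) :
    actL h (actL i v) = actL i (actL h v) + c • actL i v := by
  have := actL_bracketAux h i v
  simp only [hi, ksgn, hh, sing] at this
  simp only [map_smul, Finsupp.linearCombination_single, psgn] at this
  simp at this
  rw [this]; abel

/-- The even inner derivation attached to a tensor. -/
def inner : TT →ₗ[ℂ] TopN2 →ₗ[ℂ] TT where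
  toFun u := Finsupp.linearCombination ℂ fun i => actL i u
  map_add' u v := topN2_hom_ext fun i => by simp [sing]
  map_smul' c v := topN2_hom_ext fun i => by simp [sing]

lemma inner_sing (u : TT) (i : N2Idx) : inner u (sing i) = actL i u := by
  simp [inner, sing]

/-- Coordinates of a vector along the generator `a`, as a Laurent polynomial. -/
def comp (a : N2Gen) : TopN2 →ₗ[ℂ] ℂ[T;T⁻¹] :=
  Finsupp.linearCombination ℂ fun i => if i.1 = a then T i.2 else 0

/-- Sum of the coordinates of a vector along the generator `a`. -/
def total (a : N2Gen) : TopN2 →ₗ[ℂ] ℂ :=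
  Finsupp.linearCombination ℂ fun i => if i.1 = a then 1 else 0

/-- Coordinates of a tensor along `a ⊗ b`, as a Laurent polynomial recording the degree of the
left factor. -/
def coord (a b : N2Gen) : TT →ₗ[ℂ] ℂ[T;T⁻¹] :=
  Finsupp.linearCombination ℂ fun q => if q.1.1 = a ∧ q.2.1 = b then T q.1.2 else 0

lemma coord_tL (a b : N2Gen) (x y : TopN2) : coord a b (tL x y) = total b y • comp a x := by
  suffices tL.compr₂ (coord a b) = (LinearMap.lsmul ℂ ℂ[T;T⁻¹]).flip.compl₁₂ (comp a) (total b) from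
    LinearMap.congr_fun₂ this x y
  refine topN2_hom_ext fun k => topN2_hom_ext fun l => ?_
  simp only [LinearMap.compr₂_apply, tL_sing, LinearMap.compl₁₂_apply]
  by_cases h1 : k.1 = a <;> by_cases h2 : l.1 = b <;> simp [coord, comp, total, sing, h1, h2]

/-- Structure constants of the action of `H_m` and `Q_m`: the coefficient of `a_{m+n}` in
`[g_m, c_n]`, which does not depend on `n`. -/
def coef : N2Gen → ℤ → N2Gen → N2Gen → ℂ
  | .H, m, .L, .H => m
  | .H, _, .G, .G => 1
  | .H, _, .Q, .Q => -1
  | .Q, m, .L, .Q => m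
  | .Q, _, .H, .Q => 1
  | .Q, _, .G, .L => 2
  | .Q, m, .G, .H => -2 * m
  | _, _, _, _ => 0

/-- Linear combination over the four generators. -/
def genSum {M : Type*} [Add M] (f : N2Gen → M) : M := f .L + f .H + f .G + f .Q

lemma comp_adL {g : N2Gen} (hg : g = .H ∨ g = .Q) (m : ℤ) (a : N2Gen) (x : TopN2) :
    comp a (adL (g, m) x) = T m * genSum fun c => coef g m c a • comp c x := by
  suffices comp a ∘ₗ adL (g, m) =
      LinearMap.mulLeft ℂ (T m) ∘ₗ genSum fun c => coef g m c a • comp c by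
    simpa [genSum] using LinearMap.congr_fun this x
  refine topN2_hom_ext fun k => ?_
  simp only [LinearMap.comp_apply, adL_sing]
  obtain ⟨c, n⟩ := k
  rcases hg with rfl | rfl <;> cases c <;> cases a <;>
    simp [genSum, comp, bracketAux, bT, sing, coef, T_add, -T_mul, -Finsupp.single_mul]

lemma total_adL {g : N2Gen} (hg : g = .H ∨ g = .Q) (m : ℤ) (a : N2Gen) (x : TopN2) :
    total a (adL (g, m) x) = genSum fun c => coef g m c a • total c x := by
  suffices total a ∘ₗ adL (g, m) = genSum fun c => coef g m c a • total c by
    simpa [genSum] using LinearMap.congr_fun this x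
  refine topN2_hom_ext fun k => ?_
  simp only [LinearMap.comp_apply, adL_sing]
  obtain ⟨c, n⟩ := k
  rcases hg with rfl | rfl <;> cases c <;> cases a <;>
    simp [genSum, total, bracketAux, bT, sing, coef, -Finsupp.single_mul]

lemma comp_signL (i : N2Idx) (a : N2Gen) (x : TopN2) :
    comp a (signL i x) = ksgn i (a, 0) • comp a x := by
  suffices comp a ∘ₗ signL i = ksgn i (a, 0) • comp a from LinearMap.congr_fun this x
  refine topN2_hom_ext fun k => ?_
  simp only [LinearMap.comp_apply, signL_sing]
  obtain ⟨c, n⟩ := k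
  by_cases h : c = a
  · subst h; cases c <;> simp [comp, sing, ksgn, N2parity]
  · simp [comp, sing, h]

lemma coord_actL {g : N2Gen} (hg : g = .H ∨ g = .Q) (m : ℤ) (a b : N2Gen) (v : TT) :
    coord a b (actL (g, m) v) =
      T m * (genSum fun c => algebraMap ℂ ℂ[T;T⁻¹] (coef g m c a) * coord c b v) +
      algebraMap ℂ ℂ[T;T⁻¹] (ksgn (g, m) (a, 0)) *
        genSum fun c => algebraMap ℂ ℂ[T;T⁻¹] (coef g m c b) * coord a c v := by
  simp only [← Algebra.smul_def]
  suffices coord a b ∘ₗ actL (g, m) =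
      LinearMap.mulLeft ℂ (T m) ∘ₗ (genSum fun c => coef g m c a • coord c b) +
      ksgn (g, m) (a, 0) • genSum fun c => coef g m c b • coord a c by
    simpa [genSum, -T_mul] using LinearMap.congr_fun this v
  refine tt_hom_ext fun k l => ?_
  simp only [LinearMap.comp_apply, LinearMap.add_apply, LinearMap.smul_apply, actL_tL, map_add,
    coord_tL, comp_adL hg, total_adL hg, comp_signL, genSum, LinearMap.mulLeft_apply]
  simp only [mul_add, mul_smul_comm, smul_eq_mul]
  module

lemma coeff_coord {n : ℤ} {v : TT} (hv : IsDegTT n v) (a b : N2Gen) (k : ℤ) :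
    (coord a b v).coeff k = v ((a, k), (b, n - k)) := by
  simp only [coord, Finsupp.linearCombination_apply, Finsupp.sum, AddMonoidAlgebra.coeff_sum,
    Finsupp.finsetSum_apply]
  rw [Finset.sum_eq_single ((a, k), (b, n - k))]
  · simp
  · rintro ⟨⟨c, i⟩, ⟨e, j⟩⟩ hq hne
    have hd := hv _ hq
    simp only at hd
    simp only
    split_ifs with h
    · obtain ⟨rfl, rfl⟩ := h
      have : i ≠ k := by
        rintro rfl
        exact hne (by simp [← hd])
      simp [this]
    · simp
  · intro h
    simp [Finsupp.notMem_support_iff.mp h]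

lemma eq_zero_of_coord {n : ℤ} {v : TT} (hv : IsDegTT n v) (h : ∀ a b, coord a b v = 0) :
    v = 0 := by
  ext q
  by_contra hq
  have hd := hv q (Finsupp.mem_support_iff.mpr hq)
  have := coeff_coord hv q.1.1 q.2.1 q.1.2
  rw [h] at this
  apply hq
  rw [← hd] at this
  simpa using this.symm

lemma coord_eq_zero_of_charge {c : ℤ} {v : TT} (hv : actL (.H, 0) v = (c : ℂ) • v) {a b : N2Gen}
    (hab : charge a + charge b ≠ c) : coord a b v = 0 := by
  rw [coord, Finsupp.linearCombination_apply]
  refine Finset.sum_eq_zero fun q hq => ?_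
  dsimp only
  split_ifs with h
  · exfalso
    obtain ⟨rfl, rfl⟩ := h
    have := DFunLike.congr_fun hv q
    rw [actL_H_zero_apply, Finsupp.smul_apply, smul_eq_mul,
      mul_left_inj' (Finsupp.mem_support_iff.mp hq), Int.cast_inj] at this
    exact hab this
  · simp

/-- The tensor of degree `0` along `a ⊗ b` with prescribed coordinates. -/
def tensorOf (a b : N2Gen) : ℂ[T;T⁻¹] →ₗ[ℂ] TT :=
  Finsupp.linearCombination ℂ (fun i : ℤ => (Finsupp.single ((a, i), (b, -i)) 1 : TT)) ∘ₗ
    (AddMonoidAlgebra.coeffLinearEquiv ℂ).toLinearMap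

lemma laurent_hom_ext {M : Type*} [AddCommMonoid M] [Module ℂ M] {f g : ℂ[T;T⁻¹] →ₗ[ℂ] M}
    (h : ∀ n, f (T n) = g (T n)) : f = g :=
  AddMonoidAlgebra.lhom_ext' fun n => LinearMap.ext_ring (h n)

lemma tensorOf_T (a b : N2Gen) (n : ℤ) :
    tensorOf a b (T n) = Finsupp.single ((a, n), (b, -n)) 1 := by
  change Finsupp.linearCombination ℂ _ (Finsupp.single n (1 : ℂ)) = _
  simp

lemma coord_tensorOf (a b a' b' : N2Gen) (p : ℂ[T;T⁻¹]) :
    coord a' b' (tensorOf a b p) = if a = a' ∧ b = b' then p else 0 := by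
  suffices coord a' b' ∘ₗ tensorOf a b = if a = a' ∧ b = b' then LinearMap.id else 0 by
    have := LinearMap.congr_fun this p
    split_ifs at this ⊢ <;> simpa using this
  refine laurent_hom_ext fun n => ?_
  split_ifs with h <;> simp [tensorOf_T, coord, h]

lemma isDegTT_tensorOf (a b : N2Gen) (p : ℂ[T;T⁻¹]) : IsDegTT 0 (tensorOf a b p) := by
  rw [isDegTT_iff]
  suffices actL (.L, 0) ∘ₗ tensorOf a b = 0 by simpa using LinearMap.congr_fun this p
  refine laurent_hom_ext fun n => ?_
  ext q
  by_cases hq : ((a, n), (b, -n)) = q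
  · subst hq; simp [tensorOf_T, actL_L_zero_apply]
  · simp [tensorOf_T, actL_L_zero_apply, hq]

lemma actL_H_zero_tensorOf {a b : N2Gen} (h : charge a + charge b = 0) (p : ℂ[T;T⁻¹]) :
    actL (.H, 0) (tensorOf a b p) = 0 := by
  suffices actL (.H, 0) ∘ₗ tensorOf a b = 0 by simpa using LinearMap.congr_fun this p
  refine laurent_hom_ext fun n => ?_
  ext q
  by_cases hq : ((a, n), (b, -n)) = q
  · subst hq; simp [tensorOf_T, actL_H_zero_apply, h]
  · simp [tensorOf_T, actL_H_zero_apply, hq]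

/-- Evaluation of a Laurent polynomial at `1`. -/
def evalOne : ℂ[T;T⁻¹] →+* ℂ := eval₂ (RingHom.id ℂ) 1

@[simp] lemma evalOne_T (n : ℤ) : evalOne (T n) = 1 := by simp [evalOne]

@[simp] lemma evalOne_algebraMap (c : ℂ) : evalOne (algebraMap ℂ ℂ[T;T⁻¹] c) = c := by
  rw [← C_eq_algebraMap]; simp [evalOne]

lemma exists_mul_of_evalOne_eq_zero {p : ℂ[T;T⁻¹]} (h : evalOne p = 0) :
    ∃ r, (T 1 - 1) * r = p := by
  obtain ⟨n, f, hf⟩ := exists_T_pow p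
  have h1 : f.IsRoot 1 := by
    have := congrArg evalOne hf
    rw [map_mul, h, zero_mul, evalOne, eval₂_toLaurent] at this
    simpa [Polynomial.IsRoot, Polynomial.eval₂_eq_eval_map] using this
  obtain ⟨g, rfl⟩ := Polynomial.dvd_iff_isRoot.mpr h1
  refine ⟨Polynomial.toLaurent g * T (-n), ?_⟩
  have h2 : (T (n : ℤ) : ℂ[T;T⁻¹]) * T (-n) = 1 := by rw [← T_add]; simp
  simp only [map_mul, map_sub, Polynomial.toLaurent_X, map_one] at hf
  linear_combination T (-n) * hf + p * h2

/-- The sum of the coordinates of a tensor along `G ⊗ Q`, or `Q ⊗ G`, is an eigenfunction of the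
action of `L_m` up to a shift by the degree. -/
lemma evalOne_coord_actL_L {a b : N2Gen} (hab : a = .G ∧ b = .Q ∨ a = .Q ∧ b = .G) (m : ℤ)
    {n : ℤ} {v : TT} (hv : IsDegTT n v) :
    evalOne (coord a b (actL (.L, m) v)) = (m - n) * evalOne (coord a b v) := by
  have smul (c : ℂ) (p : ℂ[T;T⁻¹]) : evalOne (c • p) = c * evalOne p := by
    rw [Algebra.smul_def, map_mul, evalOne_algebraMap]
  let E : ℂ[T;T⁻¹] →ₗ[ℂ] ℂ := { evalOne with map_smul' := smul }
  have key : E ∘ₗ coord a b ∘ₗ actL (.L, m) =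
      (m : ℂ) • (E ∘ₗ coord a b) + E ∘ₗ coord a b ∘ₗ actL (.L, 0) := by
    refine tt_hom_ext fun ⟨c, k⟩ ⟨e, l⟩ => ?_
    simp only [LinearMap.comp_apply, LinearMap.add_apply, LinearMap.smul_apply, actL_tL, adL_sing,
      signL_sing, map_add, map_smul, coord_tL]
    rcases hab with ⟨rfl, rfl⟩ | ⟨rfl, rfl⟩ <;> cases c <;> cases e <;>
      simp [E, comp, total, sing, bracketAux, bT, ksgn, N2parity, psgn, smul] <;> ring
  have h := LinearMap.congr_fun key v
  simp only [LinearMap.comp_apply, LinearMap.add_apply, LinearMap.smul_apply,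
    (isDegTT_iff n v).mp hv, map_smul] at h
  change evalOne _ = (m : ℂ) * evalOne _ + -(n : ℂ) * evalOne _ at h
  rw [h]; ring

lemma C_two : (C 2 : ℂ[T;T⁻¹]) = 2 := map_ofNat C 2

lemma two_ne_zero : (2 : ℂ[T;T⁻¹]) ≠ 0 := fun h => by
  simpa [map_ofNat evalOne 2] using congrArg evalOne h

lemma coord_LQ_actL_Q (k : ℤ) (v : TT) : coord .L .Q (actL (.Q, k) v) =
    T k * (2 * coord .G .Q v) + ((k : ℂ[T;T⁻¹]) * coord .L .L v + coord .L .H v) := by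
  rw [coord_actL (Or.inr rfl)]; simp [genSum, coef, ksgn, N2parity, psgn, C_two]

lemma coord_QL_actL_Q (k : ℤ) (v : TT) : coord .Q .L (actL (.Q, k) v) =
    T k * ((k : ℂ[T;T⁻¹]) * coord .L .L v + coord .H .L v) - 2 * coord .Q .G v := by
  rw [coord_actL (Or.inr rfl)]; simp [genSum, coef, ksgn, N2parity, psgn, C_two]; ring

lemma coord_QH_actL_Q (k : ℤ) (v : TT) : coord .Q .H (actL (.Q, k) v) =
    T k * ((k : ℂ[T;T⁻¹]) * coord .L .H v + coord .H .H v) + 2 * (k : ℂ[T;T⁻¹]) * coord .Q .G v := by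
  rw [coord_actL (Or.inr rfl)]; simp [genSum, coef, ksgn, N2parity, psgn, C_two]

lemma coord_HQ_actL_Q (k : ℤ) (v : TT) : coord .H .Q (actL (.Q, k) v) =
    ((k : ℂ[T;T⁻¹]) * coord .H .L v + coord .H .H v) - T k * (2 * (k : ℂ[T;T⁻¹]) * coord .G .Q v) := by
  rw [coord_actL (Or.inr rfl)]; simp [genSum, coef, ksgn, N2parity, psgn, C_two]; ring

lemma coord_QQ_actL_Q (k : ℤ) (v : TT) : coord .Q .Q (actL (.Q, k) v) =
    T k * ((k : ℂ[T;T⁻¹]) * coord .L .Q v + coord .H .Q v) - ((k : ℂ[T;T⁻¹]) * coord .Q .L v + coord .Q .H v) := by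
  rw [coord_actL (Or.inr rfl)]; simp [genSum, coef, ksgn, N2parity, psgn]; ring

lemma coord_QG_actL_Q (k : ℤ) (v : TT) : coord .Q .G (actL (.Q, k) v) =
    T k * ((k : ℂ[T;T⁻¹]) * coord .L .G v + coord .H .G v) := by
  rw [coord_actL (Or.inr rfl)]; simp [genSum, coef, ksgn, N2parity, psgn]

lemma coord_GQ_actL_Q (k : ℤ) (v : TT) : coord .G .Q (actL (.Q, k) v) =
    -((k : ℂ[T;T⁻¹]) * coord .G .L v + coord .G .H v) := by
  rw [coord_actL (Or.inr rfl)]; simp [genSum, coef, ksgn, N2parity, psgn]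

lemma coord_LL_actL_H (m : ℤ) (v : TT) : coord .L .L (actL (.H, m) v) = 0 := by
  rw [coord_actL (Or.inl rfl)]; simp [genSum, coef, ksgn, N2parity, psgn]

lemma coord_LH_actL_H (m : ℤ) (v : TT) : coord .L .H (actL (.H, m) v) = (m : ℂ[T;T⁻¹]) * coord .L .L v := by
  rw [coord_actL (Or.inl rfl)]; simp [genSum, coef, ksgn, N2parity, psgn]

lemma coord_HL_actL_H (m : ℤ) (v : TT) :
    coord .H .L (actL (.H, m) v) = T m * ((m : ℂ[T;T⁻¹]) * coord .L .L v) := by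
  rw [coord_actL (Or.inl rfl)]; simp [genSum, coef, ksgn, N2parity, psgn]

lemma coord_GQ_actL_H (m : ℤ) (v : TT) :
    coord .G .Q (actL (.H, m) v) = (T m - 1) * coord .G .Q v := by
  rw [coord_actL (Or.inl rfl)]; simp [genSum, coef, ksgn, N2parity, psgn]; ring

lemma coord_QG_actL_H (m : ℤ) (v : TT) :
    coord .Q .G (actL (.H, m) v) = -(T m - 1) * coord .Q .G v := by
  rw [coord_actL (Or.inl rfl)]; simp [genSum, coef, ksgn, N2parity, psgn]; ring

lemma coord_LQ_actL_H (m : ℤ) (v : TT) : coord .L .Q (actL (.H, m) v) = -coord .L .Q v := by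
  rw [coord_actL (Or.inl rfl)]; simp [genSum, coef, ksgn, N2parity, psgn]

lemma coord_QL_actL_H (m : ℤ) (v : TT) :
    coord .Q .L (actL (.H, m) v) = -(T m * coord .Q .L v) := by
  rw [coord_actL (Or.inl rfl)]; simp [genSum, coef, ksgn, N2parity, psgn]

lemma coord_QH_actL_H (m : ℤ) (v : TT) :
    coord .Q .H (actL (.H, m) v) = (m : ℂ[T;T⁻¹]) * coord .Q .L v - T m * coord .Q .H v := by
  rw [coord_actL (Or.inl rfl)]; simp [genSum, coef, ksgn, N2parity, psgn]; ring

lemma coord_HQ_actL_H (m : ℤ) (v : TT) :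
    coord .H .Q (actL (.H, m) v) = T m * ((m : ℂ[T;T⁻¹]) * coord .L .Q v) - coord .H .Q v := by
  rw [coord_actL (Or.inl rfl)]; simp [genSum, coef, ksgn, N2parity, psgn]; ring

lemma T_one_sub_one_ne_zero : (T 1 - 1 : ℂ[T;T⁻¹]) ≠ 0 := fun h => by
  have := congrArg (fun p : ℂ[T;T⁻¹] => p.coeff 1) (sub_eq_zero.mp h)
  simp [← T_zero] at this

lemma T_ne_zero (n : ℤ) : (T n : ℂ[T;T⁻¹]) ≠ 0 := (isUnit_T n).ne_zero

lemma T_two : (T 2 : ℂ[T;T⁻¹]) = T 1 ^ 2 := by rw [T_pow]; rfl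

/-- Faithfulness of the action of the `Q_k`, for `k` large, in charge `0`. -/
lemma eq_zero_of_actL_Q_of_charge_zero {n : ℤ} {v : TT} (hv : IsDegTT n v)
    (hc : actL (.H, 0) v = 0) {K : ℕ} (h : ∀ k : ℕ, K ≤ k → actL (.Q, k) v = 0) : v = 0 := by
  have x0 := T_one_sub_one_ne_zero
  have t0 := T_ne_zero K
  have e (a : N2Gen) (k : ℕ) (hk : K ≤ k) := congrArg (coord a .Q) (h k hk)
  have e' (a : N2Gen) (k : ℕ) (hk : K ≤ k) := congrArg (coord .Q a) (h k hk)
  have T1 : (T ((K + 1 : ℕ) : ℤ) : ℂ[T;T⁻¹]) = T K * T 1 := by rw [← T_add]; push_cast; rfl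
  have T2 : (T ((K + 2 : ℕ) : ℤ) : ℂ[T;T⁻¹]) = T K * T 1 ^ 2 := by
    rw [← T_two, ← T_add]; push_cast; rfl
  have a0 := e .L K le_rfl
  have a1 := e .L (K + 1) (by omega)
  have a2 := e .L (K + 2) (by omega)
  have b0 := e' .L K le_rfl
  have b1 := e' .L (K + 1) (by omega)
  have c0 := e .H K le_rfl
  rw [coord_LQ_actL_Q, map_zero] at a0 a1 a2
  rw [coord_QL_actL_Q, map_zero] at b0 b1
  rw [coord_HQ_actL_Q, map_zero] at c0
  rw [T1] at a1 b1
  rw [T2] at a2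
  push_cast at a0 a1 a2 b0 b1 c0
  have f : coord .G .Q v = 0 := by
    have : 2 * (T K * (T 1 - 1) ^ 2 * coord .G .Q v) = 0 := by linear_combination a2 - 2 * a1 + a0
    simpa [x0, t0, two_ne_zero] using this
  have a : coord .L .L v = 0 := by
    rw [f] at a0 a1; linear_combination a1 - a0
  have b : coord .L .H v = 0 := by
    rw [f, a] at a0; linear_combination a0
  have c : coord .H .L v = 0 := by
    have : T K * (T 1 - 1) * coord .H .L v = 0 := by rw [a] at b0 b1; linear_combination b1 - b0
    simpa [x0, t0, two_ne_zero] using this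
  have g : coord .Q .G v = 0 := by
    rw [a, c] at b0; simpa [two_ne_zero] using b0
  have d : coord .H .H v = 0 := by
    rw [c, f] at c0; linear_combination c0
  refine eq_zero_of_coord hv fun i j => ?_
  by_cases hij : charge i + charge j = 0
  · cases i <;> cases j <;> first | exact absurd hij (by decide) | simp only [a, b, c, d, f, g]
  · exact coord_eq_zero_of_charge (c := 0) (by simpa using hc) hij

/-- Faithfulness of the action of the `Q_k`, for `k` large, in charge `1`. -/
lemma eq_zero_of_actL_Q_of_charge_one {n : ℤ} {v : TT} (hv : IsDegTT n v)
    (hc : actL (.H, 0) v = v) {K : ℕ} (h : ∀ k : ℕ, K ≤ k → actL (.Q, k) v = 0) : v = 0 := by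
  have a0 := congrArg (coord .Q .G) (h K le_rfl)
  have a1 := congrArg (coord .Q .G) (h (K + 1) (by omega))
  have b0 := congrArg (coord .G .Q) (h K le_rfl)
  have b1 := congrArg (coord .G .Q) (h (K + 1) (by omega))
  simp only [coord_QG_actL_Q, coord_GQ_actL_Q, map_zero, mul_eq_zero, T_ne_zero, false_or]
    at a0 a1 b0 b1
  push_cast at a0 a1 b0 b1
  have p : coord .L .G v = 0 := by linear_combination a1 - a0
  have q : coord .H .G v = 0 := by rw [p] at a0; linear_combination a0
  have r : coord .G .L v = 0 := by linear_combination b0 - b1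
  have s : coord .G .H v = 0 := by rw [r] at b0; linear_combination -b0
  refine eq_zero_of_coord hv fun i j => ?_
  by_cases hij : charge i + charge j = 1
  · cases i <;> cases j <;> first | exact absurd hij (by decide) | simp only [p, q, r, s]
  · exact coord_eq_zero_of_charge (c := 1) (by simpa using hc) hij

/-- Even one-cocycles of degree zero that commute with `H_0`. -/
structure IsEvenCocycle (D : TopN2 →ₗ[ℂ] TT) : Prop where
  cocycle : ∀ i j, D (bracketAux i j) = actL i (D (sing j)) - ksgn i j • actL j (D (sing i))
  degree : ∀ i, IsDegTT i.2 (D (sing i))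
  charge : ∀ i, actL (.H, 0) (D (sing i)) = (charge i.1 : ℂ) • D (sing i)

lemma inner_bracketAux (u : TT) (i j : N2Idx) : inner u (bracketAux i j) =
    actL i (inner u (sing j)) - ksgn i j • actL j (inner u (sing i)) := by
  rw [inner_sing, inner_sing, ← actL_bracketAux]; rfl

lemma isDegTT_inner {u : TT} (hu : IsDegTT 0 u) (i : N2Idx) : IsDegTT i.2 (inner u (sing i)) := by
  rw [isDegTT_iff] at hu ⊢
  rw [inner_sing, actL_actL_of_diagonal rfl (bracketAux_L_zero i), hu]
  simp

lemma isEvenCocycle_inner {u : TT} (hu : IsDegTT 0 u) (hc : actL (.H, 0) u = 0) :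
    IsEvenCocycle (inner u) where
  cocycle := inner_bracketAux u
  degree := isDegTT_inner hu
  charge i := by
    rw [inner_sing, actL_actL_of_diagonal rfl (bracketAux_H_zero i), hc]
    simp

namespace IsEvenCocycle

variable {D D' : TopN2 →ₗ[ℂ] TT}

lemma sub (hD : IsEvenCocycle D) (hD' : IsEvenCocycle D') : IsEvenCocycle (D - D') where
  cocycle i j := by
    simp only [LinearMap.sub_apply, hD.cocycle, hD'.cocycle, map_sub]; module
  degree i := (hD.degree i).sub (hD'.degree i)
  charge i := by
    rw [LinearMap.sub_apply, map_sub, hD.charge, hD'.charge, smul_sub]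

lemma coord_eq_zero (hD : IsEvenCocycle D) (i : N2Idx) {a b : N2Gen}
    (h : N2.charge a + N2.charge b ≠ N2.charge i.1) : coord a b (D (sing i)) = 0 :=
  coord_eq_zero_of_charge (hD.charge i) h

lemma bracket_Q_H (hD : IsEvenCocycle D) (k m : ℤ) :
    D (sing (.Q, k + m)) = actL (.Q, k) (D (sing (.H, m))) - actL (.H, m) (D (sing (.Q, k))) := by
  simpa [bracketAux, bT, sing, ksgn, N2parity, psgn] using hD.cocycle (.Q, k) (.H, m)

lemma actL_Q_Q (hD : IsEvenCocycle D) (k : ℤ) : actL (.Q, k) (D (sing (.Q, k))) = 0 := by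
  have := hD.cocycle (.Q, k) (.Q, k)
  simp only [bracketAux, map_zero, ksgn, N2parity, psgn, Bool.and_self, if_true] at this
  have h : (2 : ℂ) • actL (.Q, k) (D (sing (.Q, k))) = 0 := by rw [this]; module
  simpa using h

/-- A coboundary can be subtracted so that the cocycle vanishes at `Q_0`. -/
lemma exists_sub_inner_Q_zero (hD : IsEvenCocycle D) :
    ∃ u, IsDegTT 0 u ∧ actL (.H, 0) u = 0 ∧ (D - inner u) (sing (.Q, 0)) = 0 := by
  have hC := congrArg (coord .Q .Q) (hD.actL_Q_Q 0)
  rw [coord_QQ_actL_Q] at hC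
  simp only [Int.cast_zero, T_zero, map_zero] at hC
  set w := D (sing (.Q, 0)) with hw
  set u := tensorOf .L .H (coord .L .Q w) + tensorOf .H .L (coord .Q .L w) +
    tensorOf .H .H (coord .Q .H w) with hu
  have hu0 : IsDegTT 0 u := ((isDegTT_tensorOf _ _ _).add (isDegTT_tensorOf _ _ _)).add
    (isDegTT_tensorOf _ _ _)
  have huc : actL (.H, 0) u = 0 := by
    simp only [hu, map_add]
    repeat rw [actL_H_zero_tensorOf rfl]
    simp
  have h := hD.sub (isEvenCocycle_inner hu0 huc)
  refine ⟨u, hu0, huc, eq_zero_of_coord (h.degree (.Q, 0)) fun i j => ?_⟩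
  by_cases hij : N2.charge i + N2.charge j = -1
  · cases i <;> cases j <;> first
      | exact absurd hij (by decide)
      | (rw [LinearMap.sub_apply, inner_sing, map_sub, ← hw]
         simp [coord_LQ_actL_Q, coord_QL_actL_Q, coord_QH_actL_Q, coord_HQ_actL_Q, hu,
           coord_tensorOf]
         try linear_combination hC)
  · exact h.coord_eq_zero _ hij

lemma actL_H_comm (hD : IsEvenCocycle D) (m n : ℤ) :
    actL (.H, m) (D (sing (.H, n))) = actL (.H, n) (D (sing (.H, m))) := by
  have := hD.cocycle (.H, m) (.H, n)
  simp only [bracketAux, map_zero, ksgn, N2parity, psgn, Bool.and_self, Bool.false_eq_true,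
    if_false, one_smul] at this
  exact (sub_eq_zero.mp this.symm)

lemma coord_LL_H_one (hD : IsEvenCocycle D) : coord .L .L (D (sing (.H, 1))) = 0 := by
  have h1 := congrArg (coord .L .H) (hD.actL_H_comm 1 2)
  have h2 := congrArg (coord .H .L) (hD.actL_H_comm 1 2)
  simp only [coord_LH_actL_H, coord_HL_actL_H, T_two, Int.cast_one, Int.cast_ofNat] at h1 h2
  have : 2 * (T 1 * (T 1 - 1) * coord .L .L (D (sing (.H, 1)))) = 0 := by
    linear_combination T 1 * h1 - h2
  simpa [two_ne_zero, T_ne_zero, T_one_sub_one_ne_zero] using this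

lemma evalOne_coord_H_one (hD : IsEvenCocycle D) {a b : N2Gen}
    (hab : a = .G ∧ b = .Q ∨ a = .Q ∧ b = .G) : evalOne (coord a b (D (sing (.H, 1)))) = 0 := by
  have h1 : coord a b (D (sing (.H, 2))) = (T 1 + 1) * coord a b (D (sing (.H, 1))) := by
    have h := congrArg (coord a b) (hD.actL_H_comm 1 2)
    apply mul_left_cancel₀ T_one_sub_one_ne_zero
    rcases hab with ⟨rfl, rfl⟩ | ⟨rfl, rfl⟩
    · simp only [coord_GQ_actL_H, T_two] at h
      linear_combination h
    · simp only [coord_QG_actL_H, T_two] at h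
      linear_combination -h
  have h2 := hD.cocycle (.L, 1) (.H, 1)
  simp only [bracketAux, bT, map_smul, ksgn, N2parity, psgn, Bool.and_self, Bool.false_eq_true,
    if_false, one_smul] at h2
  have h3 : evalOne (coord a b (actL (.H, 1) (D (sing (.L, 1))))) = 0 := by
    rcases hab with ⟨rfl, rfl⟩ | ⟨rfl, rfl⟩
    · simp [coord_GQ_actL_H]
    · simp [coord_QG_actL_H]
  have h4 := congrArg (fun v => evalOne (coord a b v)) h2
  simp only [map_sub, h3, evalOne_coord_actL_L hab 1 (hD.degree (.H, 1)), Int.cast_one,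
    neg_smul, one_smul, map_neg, sub_self, zero_mul, neg_eq_zero] at h4
  change evalOne (coord a b (D (sing (.H, 2)))) = 0 at h4
  rw [h1, map_mul, map_add, evalOne_T, map_one] at h4
  simpa [one_add_one_eq_two] using h4

/-- A coboundary vanishing at `Q_0` can be subtracted so that the value of the cocycle at `H_1` has
few coordinates. -/
lemma exists_sub_inner_H_one (hD : IsEvenCocycle D) :
    ∃ u, IsDegTT 0 u ∧ actL (.H, 0) u = 0 ∧ actL (.Q, 0) u = 0 ∧
      coord .L .L ((D - inner u) (sing (.H, 1))) = 0 ∧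
      coord .L .H ((D - inner u) (sing (.H, 1))) = 0 ∧
      coord .G .Q ((D - inner u) (sing (.H, 1))) = 0 ∧
      coord .Q .G ((D - inner u) (sing (.H, 1))) = 0 := by
  obtain ⟨f, hf⟩ := exists_mul_of_evalOne_eq_zero (hD.evalOne_coord_H_one (Or.inl ⟨rfl, rfl⟩))
  obtain ⟨g, hg⟩ := exists_mul_of_evalOne_eq_zero (hD.evalOne_coord_H_one (Or.inr ⟨rfl, rfl⟩))
  have ha := hD.coord_LL_H_one
  set w := D (sing (.H, 1)) with hw
  set u := tensorOf .L .L (coord .L .H w) + tensorOf .L .H (-2 * f) + tensorOf .G .Q f +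
    tensorOf .Q .G (-g) + tensorOf .H .L (-2 * g) with hu
  have hu0 : IsDegTT 0 u :=
    ((((isDegTT_tensorOf _ _ _).add (isDegTT_tensorOf _ _ _)).add (isDegTT_tensorOf _ _ _)).add
      (isDegTT_tensorOf _ _ _)).add (isDegTT_tensorOf _ _ _)
  have huc : actL (.H, 0) u = 0 := by
    simp only [hu, map_add]
    repeat rw [actL_H_zero_tensorOf rfl]
    simp
  have h := isEvenCocycle_inner hu0 huc
  refine ⟨u, hu0, huc, ?_, ?_⟩
  · rw [← inner_sing]
    refine eq_zero_of_coord (h.degree _) fun i j => ?_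
    by_cases hij : N2.charge i + N2.charge j = -1
    · cases i <;> cases j <;> first
        | exact absurd hij (by decide)
        | (rw [inner_sing]
           simp [coord_LQ_actL_Q, coord_QL_actL_Q, coord_QH_actL_Q, coord_HQ_actL_Q, hu,
             coord_tensorOf])
    · exact h.coord_eq_zero _ hij
  · simp only [LinearMap.sub_apply, inner_sing, map_sub, ← hw, coord_LL_actL_H, coord_LH_actL_H,
      coord_GQ_actL_H, coord_QG_actL_H, ha, ← hf, ← hg]
    simp [hu, coord_tensorOf]
    ring

lemma H_one_eq_zero (hD : IsEvenCocycle D) (hQ : D (sing (.Q, 0)) = 0)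
    (hLL : coord .L .L (D (sing (.H, 1))) = 0) (hLH : coord .L .H (D (sing (.H, 1))) = 0)
    (hGQ : coord .G .Q (D (sing (.H, 1))) = 0) (hQG : coord .Q .G (D (sing (.H, 1))) = 0) :
    D (sing (.H, 1)) = 0 := by
  have d1 : D (sing (.Q, 1)) = actL (.Q, 0) (D (sing (.H, 1))) := by
    simpa [hQ] using hD.bracket_Q_H 0 1
  have d2 : D (sing (.Q, 2)) =
      actL (.Q, 1) (D (sing (.H, 1))) - actL (.H, 1) (D (sing (.Q, 1))) := hD.bracket_Q_H 1 1
  have e1 := congrArg (coord .Q .Q) (hD.actL_Q_Q 1)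
  have e2 := congrArg (coord .Q .Q) (hD.actL_Q_Q 2)
  simp only [d2, d1, coord_QQ_actL_Q, map_sub, map_zero, coord_LQ_actL_Q, coord_QL_actL_Q,
    coord_QH_actL_Q, coord_HQ_actL_Q, coord_LQ_actL_H, coord_QL_actL_H, coord_QH_actL_H,
    coord_HQ_actL_H, hLL, hLH, hGQ, hQG, Int.cast_zero, Int.cast_one, Int.cast_ofNat, T_zero, T_two]
    at e1 e2
  have e : coord .H .H (D (sing (.H, 1))) = 0 := by
    have : (T 1 - 1) ^ 3 * coord .H .H (D (sing (.H, 1))) = 0 := by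
      linear_combination e2 + (T 1 ^ 2 - 4 * T 1 + 1) * e1
    simpa [T_one_sub_one_ne_zero] using this
  have c : coord .H .L (D (sing (.H, 1))) = 0 := by
    rw [e] at e1; linear_combination -e1
  refine eq_zero_of_coord (hD.degree _) fun i j => ?_
  by_cases hij : N2.charge i + N2.charge j = 0
  · cases i <;> cases j <;> first
      | exact absurd hij (by decide)
      | simp only [hLL, hLH, hGQ, hQG, e, c]
  · exact hD.coord_eq_zero _ hij

lemma eq_zero (hD : IsEvenCocycle D) (hQ : D (sing (.Q, 0)) = 0) (hH : D (sing (.H, 1)) = 0) :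
    D = 0 := by
  have q (k : ℕ) : D (sing (.Q, k)) = 0 := by
    induction k with
    | zero => exact hQ
    | succ k ih => simpa [ih, hH] using hD.bracket_Q_H k 1
  have q' (k m : ℤ) (h : 0 ≤ k + m) : D (sing (.Q, k + m)) = 0 := by
    lift k + m to ℕ using h with r
    exact q r
  have hHm (m : ℤ) : D (sing (.H, m)) = 0 := by
    refine eq_zero_of_actL_Q_of_charge_zero (hD.degree _)
      (by simpa [N2.charge] using hD.charge (.H, m))
      (K := m.natAbs) fun k hk => ?_
    have := hD.bracket_Q_H k m
    rw [q' _ _ (by omega), q, map_zero, sub_zero] at this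
    exact this.symm
  have hLm (m : ℤ) : D (sing (.L, m)) = 0 := by
    refine eq_zero_of_actL_Q_of_charge_zero (hD.degree _)
      (by simpa [N2.charge] using hD.charge (.L, m))
      (K := m.natAbs) fun k hk => ?_
    have := hD.cocycle (.Q, k) (.L, m)
    simp only [bracketAux, map_smul] at this
    change (k : ℂ) • D (sing (.Q, (k : ℤ) + m)) = _ at this
    rw [q' _ _ (by omega), q] at this
    simpa using this.symm
  have hGm (m : ℤ) : D (sing (.G, m)) = 0 := by
    refine eq_zero_of_actL_Q_of_charge_one (hD.degree _)
      (by simpa [N2.charge] using hD.charge (.G, m))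
      (K := 0) fun k _ => ?_
    have := hD.cocycle (.Q, k) (.G, m)
    simp only [bracketAux, map_smul, map_add] at this
    change (2 : ℂ) • D (sing (.L, (k : ℤ) + m)) + (_ : ℂ) • D (sing (.H, (k : ℤ) + m)) = _ at this
    rw [hLm, hHm, q] at this
    simpa using this.symm
  refine topN2_hom_ext ?_
  rintro ⟨a, m⟩
  cases a
  · exact hLm m
  · exact hHm m
  · exact hGm m
  · simpa [hQ, hHm] using hD.bracket_Q_H 0 m

/-- Even cocycles of degree zero commuting with `H_0` are coboundaries. -/
lemma exists_eq_inner (hD : IsEvenCocycle D) :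
    ∃ u, IsDegTT 0 u ∧ actL (.H, 0) u = 0 ∧ D = inner u := by
  obtain ⟨u, hu0, huc, hu⟩ := hD.exists_sub_inner_Q_zero
  have h := hD.sub (isEvenCocycle_inner hu0 huc)
  obtain ⟨v, hv0, hvc, hv, h1, h2, h3, h4⟩ := h.exists_sub_inner_H_one
  have h' := h.sub (isEvenCocycle_inner hv0 hvc)
  have hQ : (D - inner u - inner v) (sing (.Q, 0)) = 0 := by
    rw [LinearMap.sub_apply, hu, inner_sing, hv, sub_zero]
  have h0 := h'.eq_zero hQ (h'.H_one_eq_zero hQ h1 h2 h3 h4)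
  refine ⟨u + v, hu0.add hv0, by rw [map_add, huc, hvc, add_zero], ?_⟩
  rw [map_add, ← sub_eq_zero, ← h0]; abel

end IsEvenCocycle

lemma brk_sing (i j : N2Idx) : brk (sing i) (sing j) = bracketAux i j := by simp [brk, sing]

lemma adT2_sing (i : N2Idx) (v : TT) : adT2 (sing i) v = actL i v := by
  simp [adT2, sing, actL, Finsupp.linearCombination_apply]

lemma isParityT_sing (i : N2Idx) : IsParityT (N2parity i) (sing i) := fun j hj => by
  rw [Finset.mem_singleton.mp (Finsupp.support_single_subset hj)]

lemma isDegT_sing (i : N2Idx) : IsDegT i.2 (sing i) := fun j hj => by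
  rw [Finset.mem_singleton.mp (Finsupp.support_single_subset hj)]

lemma pparity_eq_of_charge {q : N2Idx × N2Idx} {i : N2Idx}
    (h : charge q.1.1 + charge q.2.1 = charge i.1) : pparity q = N2parity i := by
  obtain ⟨⟨a, k⟩, ⟨b, l⟩⟩ := q
  obtain ⟨c, m⟩ := i
  cases a <;> cases b <;> cases c <;> first
    | rfl
    | simp [charge] at h

lemma innerDer_eq {p : Bool} {u : TT} (hu : IsParityTT p u) : innerDer u =
    Finsupp.linearCombination ℂ fun i => psgn (p && N2parity i) • actL i u := by
  ext1 x
  rw [innerDer, Finsupp.linearCombination_apply]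
  refine Finsupp.sum_congr fun i _ => ?_
  rw [actL, Finsupp.linearCombination_apply, Finsupp.smul_sum, Finsupp.smul_sum]
  refine Finsupp.sum_congr fun q hq => ?_
  rw [hu q hq]
  module

/-- Inverse of the action of `H_0` on its nonzero eigenspaces, extended by zero. -/
def invH : TT →ₗ[ℂ] TT := Finsupp.linearCombination ℂ fun q =>
  (charge q.1.1 + charge q.2.1 : ℂ)⁻¹ • Finsupp.single q 1

lemma invH_apply (v : TT) (q : N2Idx × N2Idx) :
    invH v q = (charge q.1.1 + charge q.2.1 : ℂ)⁻¹ * v q := by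
  suffices Finsupp.lapply q ∘ₗ invH =
      (charge q.1.1 + charge q.2.1 : ℂ)⁻¹ • Finsupp.lapply q by
    simpa using LinearMap.congr_fun this v
  refine Finsupp.lhom_ext' fun r => LinearMap.ext_ring ?_
  by_cases hr : r = q
  · subst hr; simp [invH]
  · simp [invH, hr]

lemma support_invH_subset (v : TT) : (invH v).support ⊆ v.support := fun q hq => by
  rw [Finsupp.mem_support_iff, invH_apply] at hq
  exact Finsupp.mem_support_iff.mpr (right_ne_zero_of_mul hq)

lemma actL_H_zero_actL_apply (i : N2Idx) (v : TT) (q : N2Idx × N2Idx) :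
    actL i (actL (.H, 0) v) q =
      (charge q.1.1 + charge q.2.1 - charge i.1) * actL i v q := by
  have := DFunLike.congr_fun (actL_actL_of_diagonal rfl (bracketAux_H_zero i) v) q
  rw [actL_H_zero_apply, Finsupp.add_apply, Finsupp.smul_apply, smul_eq_mul] at this
  push_cast at this
  linear_combination -this

lemma actL_H_zero_invH_invH (v : TT) : actL (.H, 0) (invH (invH v)) = invH v := by
  ext q
  rw [actL_H_zero_apply, invH_apply, invH_apply]
  push_cast
  by_cases h : (charge q.1.1 + charge q.2.1 : ℂ) = 0
  · simp [h]
  · rw [mul_inv_cancel_left₀ h]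

lemma actL_H_zero_sub_invH (v : TT) : actL (.H, 0) (v - actL (.H, 0) (invH v)) = 0 := by
  ext q
  rw [actL_H_zero_apply, Finsupp.sub_apply, actL_H_zero_apply, invH_apply]
  push_cast
  by_cases h : (charge q.1.1 + charge q.2.1 : ℂ) = 0
  · simp [h]
  · rw [mul_inv_cancel_left₀ h]; simp

section Derivation

variable {p : Bool} {d : TopN2 → TT}

lemma leibniz (hd : IsHomogDer p d) (i j : N2Idx) :
    d (bracketAux i j) = psgn (p && N2parity i) • actL i (d (sing j)) -
      psgn (N2parity j && xor p (N2parity i)) • actL j (d (sing i)) := by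
  simpa only [brk_sing, adT2_sing] using
    hd.2.2.2 _ _ _ _ (isParityT_sing i) (isParityT_sing j)

/-- A homogeneous derivation coincides with an inner one outside the eigenspaces of `H_0` in which
it should take its values. -/
lemma apply_of_charge_ne (hd : IsHomogDer p d) {i : N2Idx} {q : N2Idx × N2Idx}
    (h : charge q.1.1 + charge q.2.1 ≠ charge i.1) :
    d (sing i) q = psgn (p && N2parity i) * actL i (invH (d (sing (.H, 0)))) q := by
  set w := d (sing (.H, 0)) with hw
  have h0 : (charge q.1.1 + charge q.2.1 - charge i.1 : ℂ) ≠ 0 := by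
    rw [sub_ne_zero]; exact_mod_cast h
  have h1 := DFunLike.congr_fun (leibniz hd (.H, 0) i) q
  rw [bracketAux_H_zero, hd.2.1, ← hw] at h1
  simp only [Finsupp.sub_apply, Finsupp.smul_apply, smul_eq_mul, actL_H_zero_apply,
    show N2parity (.H, 0) = false from rfl, Bool.and_false, Bool.xor_false, Bool.and_comm _ p] at h1
  have h2 := actL_H_zero_actL_apply i (w - actL (.H, 0) (invH w)) q
  rw [actL_H_zero_sub_invH, map_zero, Finsupp.zero_apply, eq_comm, mul_eq_zero_iff_left h0, map_sub,
    Finsupp.sub_apply, actL_H_zero_actL_apply, sub_eq_zero] at h2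
  apply mul_left_cancel₀ h0
  rw [h2] at h1
  rw [show psgn false = 1 from rfl] at h1
  push_cast at h1
  linear_combination -h1

lemma exists_eq_inner_of_even (hd : IsHomogDer false d)
    (hdeg : ∀ i, IsDegTT i.2 (d (sing i))) :
    ∃ u, IsDegTT 0 u ∧ IsParityTT false u ∧ ∀ i, d (sing i) = actL i u := by
  set u := invH (d (sing (.H, 0))) with hu
  have hu0 : IsDegTT 0 u := fun q hq => hdeg (.H, 0) q (support_invH_subset _ hq)
  let D : TopN2 →ₗ[ℂ] TT := { toFun := d, map_add' := hd.1, map_smul' := hd.2.1 }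
  have hD : IsEvenCocycle (D - inner u) :=
    { cocycle := fun i j => by
        have := leibniz hd i j
        simp only [Bool.false_and, Bool.false_xor, psgn, Bool.false_eq_true, if_false, one_smul,
          Bool.and_comm (N2parity j)] at this
        change d _ - _ = actL i (d _ - _) - psgn _ • actL j (d _ - _)
        rw [this, inner_bracketAux, map_sub, map_sub, ksgn, psgn]
        module
      degree := fun i => (hdeg i).sub (isDegTT_inner hu0 i)
      charge := fun i => by
        ext q
        change actL _ (d (sing i) - _) q = (_ : ℂ) • (d (sing i) - _) q
        rw [actL_H_zero_apply, smul_eq_mul]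
        by_cases h : charge q.1.1 + charge q.2.1 = charge i.1
        · rw [h]
        · rw [Finsupp.sub_apply, apply_of_charge_ne hd h, inner_sing]
          simp [psgn, hu] }
  obtain ⟨v, hv0, hvc, hv⟩ := hD.exists_eq_inner
  refine ⟨u + v, hu0.add hv0, fun q hq => ?_, fun i => ?_⟩
  · rcases Finset.mem_union.mp (Finsupp.support_add hq) with hq | hq
    · exact hd.2.2.1 _ _ (isParityT_sing (.H, 0)) q (support_invH_subset _ hq)
    · have := DFunLike.congr_fun hvc q
      rw [actL_H_zero_apply, Finsupp.zero_apply,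
        mul_eq_zero_iff_right (Finsupp.mem_support_iff.mp hq), Int.cast_eq_zero] at this
      exact pparity_eq_of_charge (i := (.H, 0)) this
  · have := LinearMap.congr_fun hv (sing i)
    rw [LinearMap.sub_apply, sub_eq_iff_eq_add', ← LinearMap.add_apply, ← map_add, inner_sing]
      at this
    exact this

lemma eq_actL_of_odd (hd : IsHomogDer true d) (i : N2Idx) :
    d (sing i) = psgn (N2parity i) • actL i (invH (d (sing (.H, 0)))) := by
  ext q
  by_cases h : charge q.1.1 + charge q.2.1 = charge i.1
  · have h1 : d (sing i) q = 0 := by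
      by_contra hq
      have := hd.2.2.1 _ _ (isParityT_sing i) q (Finsupp.mem_support_iff.mpr hq)
      rw [pparity_eq_of_charge h] at this
      simp at this
    have h2 := actL_H_zero_actL_apply i (invH (invH (d (sing (.H, 0))))) q
    rw [actL_H_zero_invH_invH, ← Int.cast_add, h, sub_self, zero_mul] at h2
    rw [h1, Finsupp.smul_apply, h2, smul_zero]
  · rw [apply_of_charge_ne hd h]; rfl

end Derivation

end N2

end

/-- Every homogeneous derivation `d₀ : T → V = T⊗T` of
degree `0` is inner: there is `u ∈ V_0` with `d₀ = u_inn`. -/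
theorem degree_zero_derivation_is_inner
    (p : Bool) (d : TopN2 → TT) (hd : IsHomogDer p d)
    (hdeg : ∀ (j : ℤ) (x : TopN2), IsDegT j x → IsDegTT j (d x)) :
    ∃ u : TT, IsDegTT 0 u ∧ d = innerDer u := by
  have hdeg' (i : N2Idx) : IsDegTT i.2 (d (sing i)) := hdeg _ _ (N2.isDegT_sing i)
  suffices ∃ u, IsDegTT 0 u ∧ IsParityTT p u ∧
      ∀ i, d (sing i) = psgn (p && N2parity i) • N2.actL i u by
    obtain ⟨u, hu0, hup, hu⟩ := this
    let D : TopN2 →ₗ[ℂ] TT := { toFun := d, map_add' := hd.1, map_smul' := hd.2.1 }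
    refine ⟨u, hu0, ?_⟩
    rw [N2.innerDer_eq hup]
    refine congrArg DFunLike.coe (N2.topN2_hom_ext (f := D) fun i => ?_)
    rw [sing, Finsupp.linearCombination_single, one_smul]
    exact hu i
  cases p with
  | false =>
    obtain ⟨u, hu0, hup, hu⟩ := N2.exists_eq_inner_of_even hd hdeg'
    exact ⟨u, hu0, hup, fun i => by simp [hu, psgn]⟩
  | true =>
    exact ⟨N2.invH (d (sing (.H, 0))),
      fun q hq => hdeg' (.H, 0) q (N2.support_invH_subset _ hq),
      fun q hq => hd.2.2.1 _ _ (N2.isParityT_sing (.H, 0)) q (N2.support_invH_subset _ hq),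
      N2.eq_actL_of_odd hd⟩
end

section
/- Let T be the centerless topological N=2 superconformal algebra, V = T⊗T with the adjoint diagonal action, and τ the super-twist map on T⊗T. If r ∈ V satisfies x·r ∈ Im(1⊗1 − τ) for all x ∈ T, then r ∈ Im(1⊗1 − τ). -/
theorem tmul2_apply (x y : TopN2) (a b : N2Idx) : tmul2 x y (a, b) = x a * y b := by
  classical
  simp only [tmul2, Finsupp.sum, Finsupp.finsetSum_apply, Finsupp.single_apply, Prod.mk.injEq,
    ite_and]
  rw [Finset.sum_eq_single a]
  · rw [Finset.sum_eq_single b] <;> simp +contextual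
  · intro i _ hi
    simp [hi]
  · intro ha
    simp [Finsupp.notMem_support_iff.mp ha]

theorem actB_apply (i : N2Idx) (q : N2Idx × N2Idx) (a b : N2Idx) :
    actB i q (a, b) = bracketAux i q.1 a * sing q.2 b
      + ksgn i q.1 * (sing q.1 a * bracketAux i q.2 b) := by
  simp [actB, tmul2_apply]

theorem adT2_sing (i : N2Idx) (v : TT) :
    adT2 (sing i) v = Finsupp.linearCombination ℂ (actB i) v := by
  simp [adT2, sing, Finsupp.linearCombination_apply]

/-- The super-twist as a linear map. -/
noncomputable def twistLin : TT →ₗ[ℂ] TT :=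
  Finsupp.linearCombination ℂ fun q => ksgn q.1 q.2 • Finsupp.single (q.2, q.1) (1 : ℂ)

theorem twistLin_apply (v : TT) : twistLin v = twist v := by
  simp [twistLin, twist, Finsupp.linearCombination_apply, mul_comm]

theorem twist_apply (v : TT) (a b : N2Idx) : twist v (a, b) = ksgn a b * v (b, a) := by
  classical
  simp only [twist, Finsupp.sum, Finsupp.finsetSum_apply, Finsupp.smul_apply,
    Finsupp.single_apply, smul_eq_mul, Prod.mk.injEq]
  rw [Finset.sum_eq_single (b, a)]
  · simp [ksgn, Bool.and_comm]
  · rintro ⟨c, d⟩ _ hne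
    rw [if_neg, mul_zero]
    rintro ⟨rfl, rfl⟩
    exact hne rfl
  · intro h
    simp [Finsupp.notMem_support_iff.mp h]

theorem twist_twist (v : TT) : twist (twist v) = v := by
  ext ⟨a, b⟩
  rw [twist_apply, twist_apply]
  simp only [ksgn, psgn]
  cases N2parity a <;> cases N2parity b <;> simp

theorem isParityT_bracketAux (i j : N2Idx) :
    IsParityT (xor (N2parity i) (N2parity j)) (bracketAux i j) := by
  classical
  intro k hk
  rw [Finsupp.mem_support_iff] at hk
  contrapose! hk
  obtain ⟨g, m⟩ := i
  obtain ⟨g', n⟩ := j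
  obtain ⟨f, l⟩ := k
  cases g <;> cases g' <;> cases f <;> simp_all [bracketAux, bT, N2parity]

theorem twist_actB (i : N2Idx) (q : N2Idx × N2Idx) :
    twist (actB i q) = ksgn q.1 q.2 • actB i (q.2, q.1) := by
  classical
  obtain ⟨a, b⟩ := q
  ext ⟨c, d⟩
  have key : ∀ x y z : N2Idx,
      ksgn z y * bracketAux i x y = ksgn x z * ksgn i z * bracketAux i x y := by
    intro x y z
    by_cases h : bracketAux i x y = 0
    · simp [h]
    · have hp := isParityT_bracketAux i x y (Finsupp.mem_support_iff.mpr h)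
      congr 1
      simp only [ksgn, psgn, hp]
      cases N2parity i <;> cases N2parity x <;> cases N2parity z <;> simp
  have sq : ∀ x y, ksgn x y * ksgn x y = 1 := by
    intro x y
    simp only [ksgn, psgn]
    split_ifs <;> simp
  have comm : ∀ x y, ksgn x y = ksgn y x := by
    intro x y
    simp [ksgn, Bool.and_comm]
  rw [twist_apply, actB_apply, Finsupp.smul_apply, actB_apply, smul_eq_mul]
  simp only [sing, Finsupp.single_apply]
  have h₁ : ksgn c d * (bracketAux i a d * if b = c then 1 else 0)
      = ksgn a b * (ksgn i b * ((if b = c then 1 else 0) * bracketAux i a d)) := by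
    split_ifs with h
    · subst h
      linear_combination key a d b
    · simp
  have h₂ : ksgn c d * (ksgn i a * ((if a = d then 1 else 0) * bracketAux i b c))
      = ksgn a b * (bracketAux i b c * if a = d then 1 else 0) := by
    split_ifs with h
    · subst h
      rw [comm c a, comm a b]
      linear_combination ksgn i a * key b c a + ksgn b a * bracketAux i b c * sq i a
    · simp
  linear_combination h₁ + h₂

theorem adT2_sing_twist (i : N2Idx) (v : TT) :
    adT2 (sing i) (twist v) = twist (adT2 (sing i) v) := by
  have h : Finsupp.linearCombination ℂ (actB i) ∘ₗ twistLin
      = twistLin ∘ₗ Finsupp.linearCombination ℂ (actB i) := by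
    refine Finsupp.lhom_ext' fun q => LinearMap.ext_ring ?_
    simp only [LinearMap.comp_apply, Finsupp.lsingle_apply, Finsupp.linearCombination_single,
      one_smul, twistLin_apply, twist_actB]
    rw [← twistLin_apply]
    simp [twistLin]
  simpa [adT2_sing, twistLin_apply] using LinearMap.congr_fun h v

/-- If the first slot `p` does not occur in `w`, the coefficient of `e_i · w` at `e_p ⊗ e_b`
only sees the action on the first tensor factor. -/
theorem adT2_sing_apply_of_fst (i j p b : N2Idx) (w : TT) (hp : ∀ c, w (p, c) = 0)
    (hj : ∀ a, a ≠ j → w (a, b) * bracketAux i a p = 0) :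
    adT2 (sing i) w (p, b) = w (j, b) * bracketAux i j p := by
  classical
  rw [adT2_sing, Finsupp.linearCombination_apply, Finsupp.sum, Finsupp.finsetSum_apply,
    Finset.sum_eq_single (j, b)]
  · rw [Finsupp.smul_apply, actB_apply, smul_eq_mul]
    by_cases h : j = p
    · simp [h, hp]
    · simp [sing, h]
  · rintro ⟨a, c⟩ _ hne
    rw [Finsupp.smul_apply, actB_apply, smul_eq_mul]
    have h₂ : w (a, c) * sing a p = 0 := by
      by_cases h : a = p
      · simp [h, hp]
      · simp [sing, h]
    have h₁ : w (a, c) * (bracketAux i a p * sing c b) = 0 := by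
      by_cases h : c = b
      · subst h
        rw [← mul_assoc, hj a fun h => hne (by rw [h]), zero_mul]
      · simp [sing, h]
    linear_combination h₁ + ksgn i a * bracketAux i c b * h₂
  · intro h
    simp [Finsupp.notMem_support_iff.mp h]

theorem exists_forall_lt_apply_eq_zero (w : TT) :
    ∃ M : ℤ, ∀ g n c, M < n → w ((g, n), c) = 0 := by
  obtain ⟨M, hM⟩ := (w.support.image fun q => q.1.2).bddAbove
  refine ⟨M, fun g n c hn => ?_⟩
  by_contra h
  have := hM (Finset.mem_coe.mpr (Finset.mem_image_of_mem (fun q => q.1.2)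
    (Finsupp.mem_support_iff.mpr h)))
  exact absurd hn (not_lt.mpr this)

/-- `T ⊗ T` has no nonzero invariants. -/
theorem eq_zero_of_adT2_sing_eq_zero (w : TT) (h : ∀ i, adT2 (sing i) w = 0) : w = 0 := by
  classical
  obtain ⟨M, hM⟩ := exists_forall_lt_apply_eq_zero w
  have large : ∀ n : ℤ, ∃ m : ℤ, M < m + n ∧ m ≠ 0 := fun n =>
    ⟨max (M - n + 1) 1, by omega, by omega⟩
  have hL : ∀ n b, w ((N2Gen.L, n), b) = 0 := by
    intro n b
    obtain ⟨m, hm, hm0⟩ := large n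
    have := adT2_sing_apply_of_fst (N2Gen.H, m) (N2Gen.L, n) (N2Gen.H, m + n) b w
      (fun c => hM _ _ _ hm) (by
        rintro ⟨g, k⟩ hk
        cases g <;> simp_all [bracketAux, bT])
    simpa [h, bracketAux, bT, hm0] using this
  have hG : ∀ n b, w ((N2Gen.G, n), b) = 0 := by
    intro n b
    obtain ⟨m, hm, -⟩ := large n
    have := adT2_sing_apply_of_fst (N2Gen.H, m) (N2Gen.G, n) (N2Gen.G, m + n) b w
      (fun c => hM _ _ _ hm) (by
        rintro ⟨g, k⟩ hk
        cases g <;> simp_all [bracketAux, bT])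
    simpa [h, bracketAux, bT] using this.symm
  have hQ : ∀ n b, w ((N2Gen.Q, n), b) = 0 := by
    intro n b
    obtain ⟨m, hm, -⟩ := large n
    have := adT2_sing_apply_of_fst (N2Gen.H, m) (N2Gen.Q, n) (N2Gen.Q, m + n) b w
      (fun c => hM _ _ _ hm) (by
        rintro ⟨g, k⟩ hk
        cases g <;> simp_all [bracketAux, bT])
    simpa [h, bracketAux, bT] using this
  have hH : ∀ n b, w ((N2Gen.H, n), b) = 0 := by
    intro n b
    obtain ⟨m, hm, -⟩ := large n
    have := adT2_sing_apply_of_fst (N2Gen.Q, m) (N2Gen.H, n) (N2Gen.Q, m + n) b w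
      (fun c => hM _ _ _ hm) (by
        rintro ⟨g, k⟩ hk
        cases g <;> simp_all [bracketAux, bT])
    simpa [h, bracketAux, bT] using this.symm
  ext ⟨⟨g, n⟩, b⟩
  cases g
  · exact hL n b
  · exact hH n b
  · exact hG n b
  · exact hQ n b

/-- If `r ∈ T⊗T` satisfies `x·r ∈ Im(1⊗1 − τ)` for every
`x ∈ T`, then `r ∈ Im(1⊗1 − τ)`. -/
theorem mem_skew_of_adT2_mem_skew
    (r : TT) (h : ∀ x : TopN2, ∃ s : TT, adT2 x r = s - twist s) :
    ∃ s : TT, r = s - twist s := by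
  have hinv : r + twist r = 0 := by
    refine eq_zero_of_adT2_sing_eq_zero _ fun i => ?_
    obtain ⟨s, hs⟩ := h (sing i)
    have hadd : adT2 (sing i) (r + twist r) = adT2 (sing i) r + adT2 (sing i) (twist r) := by
      simp only [adT2_sing, map_add]
    rw [hadd, adT2_sing_twist, hs, ← twistLin_apply (s - twist s), map_sub, twistLin_apply,
      twistLin_apply, twist_twist]
    abel
  refine ⟨(2⁻¹ : ℂ) • r, ?_⟩
  rw [← twistLin_apply, map_smul, twistLin_apply, eq_neg_of_add_eq_zero_right hinv]
  module
end
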